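/- Let a and n be positive integers with gcd(n,a) = 1. Then R(n;a) = (1/φ(a)) · Σ_{χ mod a} χ̄(−n) · Σ_{u | n²} χ(u), where the outer sum runs over all Dirichlet characters χ modulo a and the inner sum over the positive divisors u of n². -/

import Mathlib

/-- `R n a` is the number of ordered pairs `(x, y)` of positive integers
satisfying `a / n = 1 / x + 1 / y`. -/
noncomputable def R (n a : ℕ) : ℕ :=
  Nat.card {p : ℕ × ℕ | 0 < p.1 ∧ 0 < p.2 ∧ (a : ℚ) / n = 1 / p.1 + 1 / p.2}

theorem div_eq_one_div_add_one_div_iff {a n x y : ℕ} (hn : 0 < n) (hx : 0 < x) (hy : 0 < y) :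
    (a : ℚ) / n = 1 / x + 1 / y ↔ a * (x * y) = n * (x + y) := by
  have hn' : (n : ℚ) ≠ 0 := by positivity
  have hx' : (x : ℚ) ≠ 0 := by positivity
  have hy' : (y : ℚ) ≠ 0 := by positivity
  rw [div_add_div _ _ hx' hy', div_eq_div_iff hn' (mul_ne_zero hx' hy'),
    ← @Nat.cast_inj ℚ]
  push_cast
  constructor <;> intro h <;> linarith

theorem dvd_add_of_mul_eq_sq {a n u v : ℕ} (h : Nat.Coprime n a) (huv : u * v = n ^ 2)
    (hu : a ∣ u + n) : a ∣ v + n := by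
  have key : a ∣ n * (v + n) := by
    have h1 : n * (v + n) = (u + n) * v := by nlinarith [huv]
    rw [h1]
    exact hu.mul_right v
  exact h.symm.dvd_of_dvd_mul_left key

theorem R_eq_card_divisors_filter {a n : ℕ} (ha : 0 < a) (hn : 0 < n) (h : Nat.Coprime n a) :
    R n a = ((n ^ 2).divisors.filter fun u => a ∣ u + n).card := by
  have hset : {p : ℕ × ℕ | 0 < p.1 ∧ 0 < p.2 ∧ (a : ℚ) / n = 1 / p.1 + 1 / p.2} =
      (((n ^ 2).divisors.filter fun u => a ∣ u + n).image
        fun u => ((u + n) / a, (n ^ 2 / u + n) / a) : Finset (ℕ × ℕ)) := by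
    ext ⟨x, y⟩
    simp only [Set.mem_ofPred_eq, Finset.coe_image, Set.mem_image, Finset.mem_coe,
      Finset.mem_filter, Nat.mem_divisors, Prod.mk.injEq]
    constructor
    · rintro ⟨hx, hy, hxy⟩
      rw [div_eq_one_div_add_one_div_iff hn hx hy] at hxy
      have hxn : n < a * x := by
        have : y * n < y * (a * x) := by nlinarith [Nat.mul_pos hn hx]
        exact lt_of_mul_lt_mul_left this (Nat.zero_le y)
      have hyn : n < a * y := by
        have : x * n < x * (a * y) := by nlinarith [Nat.mul_pos hn hy]
        exact lt_of_mul_lt_mul_left this (Nat.zero_le x)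
      obtain ⟨u, hu⟩ := Nat.exists_eq_add_of_lt hxn
      obtain ⟨v, hv⟩ := Nat.exists_eq_add_of_lt hyn
      have huv : (u + 1) * (v + 1) = n ^ 2 := by
        zify at *
        have hu' : (u : ℤ) + 1 = a * x - n := by linarith
        have hv' : (v : ℤ) + 1 = a * y - n := by linarith
        rw [hu', hv']
        linear_combination (a : ℤ) * hxy
      have hdiv : n ^ 2 / (u + 1) = v + 1 := by
        rw [← huv, Nat.mul_div_cancel_left _ u.succ_pos]
      refine ⟨u + 1, ⟨⟨⟨v + 1, huv.symm⟩, by positivity⟩, ⟨x, by linarith⟩⟩, ?_, ?_⟩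
      · rw [show u + 1 + n = a * x by linarith, Nat.mul_div_cancel_left _ ha]
      · rw [hdiv, show v + 1 + n = a * y by linarith, Nat.mul_div_cancel_left _ ha]
    · rintro ⟨u, ⟨⟨⟨v, huv⟩, -⟩, hu⟩, rfl, rfl⟩
      have hu0 : 0 < u := Nat.pos_of_ne_zero fun h0 => by simp [h0, hn.ne'] at huv
      have hv := dvd_add_of_mul_eq_sq h huv.symm hu
      rw [huv, Nat.mul_div_cancel_left _ hu0]
      obtain ⟨x, hx⟩ := hu
      obtain ⟨y, hy⟩ := hv
      rw [hx, hy, Nat.mul_div_cancel_left _ ha, Nat.mul_div_cancel_left _ ha]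
      have hx0 : 0 < x := Nat.pos_of_ne_zero fun h0 => by subst h0; omega
      have hy0 : 0 < y := Nat.pos_of_ne_zero fun h0 => by subst h0; omega
      refine ⟨hx0, hy0, (div_eq_one_div_add_one_div_iff hn hx0 hy0).2 ?_⟩
      apply Nat.eq_of_mul_eq_mul_left ha
      zify at *
      have hu' : (u : ℤ) = a * x - n := by linarith
      have hv' : (v : ℤ) = a * y - n := by linarith
      rw [hu', hv'] at huv
      linear_combination -huv
  rw [R, hset]
  simp only [SetLike.coe_sort_coe, Nat.card_eq_fintype_card, Fintype.card_coe]
  apply Finset.card_image_of_injOn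
  intro u hu v hv huv
  simp only [Finset.coe_filter, Set.mem_ofPred_eq, Prod.mk.injEq] at hu hv huv
  have := (Nat.div_left_inj hu.2 hv.2).1 huv.1
  omega

theorem DirichletCharacter.sum_conj_mul_eq {a : ℕ} [NeZero a] {b : ZMod a} (hb : IsUnit b)
    (c : ZMod a) :
    ∑ χ : DirichletCharacter ℂ a, (starRingEnd ℂ) (χ b) * χ c =
      if b = c then (a.totient : ℂ) else 0 := by
  rw [← DirichletCharacter.sum_char_inv_mul_char_eq ℂ hb c]
  refine Finset.sum_congr rfl fun χ _ => ?_
  obtain ⟨b, rfl⟩ := hb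
  rw [starRingEnd_apply, MulChar.star_apply', MulChar.inv_apply, Ring.inverse_unit,
    ZMod.inv_coe_unit]

/-- For `gcd(n, a) = 1`,
`R(n; a) = (1/φ(a)) ∑_{χ mod a} χ̄(-n) ∑_{u ∣ n²} χ(u)`. -/
theorem stmt12 (a n : ℕ) (ha : 0 < a) (hn : 0 < n) (h : Nat.gcd n a = 1) :
    (R n a : ℂ) = (1 / (a.totient : ℂ)) *
      ∑ χ : DirichletCharacter ℂ a,
        (starRingEnd ℂ) (χ (-(n : ZMod a))) *
          ∑ u ∈ (n ^ 2).divisors, χ (u : ZMod a) := by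
  have : NeZero a := ⟨ha.ne'⟩
  have hunit : IsUnit (-(n : ZMod a)) := ((ZMod.isUnit_iff_coprime n a).2 h).neg
  have htot : (a.totient : ℂ) ≠ 0 := Nat.cast_ne_zero.2 (Nat.totient_pos.2 ha).ne'
  have hiff (u : ℕ) : -(n : ZMod a) = u ↔ a ∣ u + n := by
    rw [← ZMod.natCast_eq_zero_iff, Nat.cast_add, neg_eq_iff_add_eq_zero, add_comm]
  have hsum : ∑ χ : DirichletCharacter ℂ a, (starRingEnd ℂ) (χ (-(n : ZMod a))) *
      ∑ u ∈ (n ^ 2).divisors, χ (u : ZMod a) = R n a * (a.totient : ℂ) := by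
    simp_rw [Finset.mul_sum]
    rw [Finset.sum_comm, R_eq_card_divisors_filter ha hn h]
    simp_rw [DirichletCharacter.sum_conj_mul_eq hunit, hiff]
    rw [← Finset.sum_filter, Finset.sum_const, nsmul_eq_mul]
  rw [hsum]
  field_simp
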